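/- (Equation (5): KL divergence from Dir(α) to the uniform Dirichlet Dir(1,…,1)) The density of the uniform Dirichlet Dir(1,…,1) is the constant Γ(K) on T, and ∫_T dirα(x) · log(dirα(x) / Γ(K)) dx = log(Γ(α₀) / (Γ(K) · ∏_k Γ(α k))) + ∑_k (α k − 1) · (ψ(α k) − ψ(α₀)), where ψ(t) = deriv (fun s => Real.log (Real.Gamma s)) t is the digamma function. -/

import Mathlib

open MeasureTheory

/-- The open parameter domain of the probability simplex over `K` outcomes:
vectors of the first `K-1` coordinates, all positive, summing to less than 1. -/
def simplexT (K : ℕ) : Set (Fin (K - 1) → ℝ) :=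
  {x | (∀ i, 0 < x i) ∧ ∑ i, x i < 1}

/-- The point of the probability simplex over `K` outcomes determined by its
first `K-1` coordinates: `π(x) i = x i` for `i < K-1` and
`π(x) (K-1) = 1 - ∑ᵢ x i`. -/
noncomputable def simplexCoord (K : ℕ) (x : Fin (K - 1) → ℝ) (i : Fin K) : ℝ :=
  if h : (i : ℕ) < K - 1 then x ⟨i, h⟩ else 1 - ∑ m, x m

/-- The Dirichlet density with parameter `α`, in the simplex parametrization. -/
noncomputable def dirDensity (K : ℕ) (α : Fin K → ℝ) (x : Fin (K - 1) → ℝ) : ℝ :=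
  (Real.Gamma (∑ k, α k) / ∏ k, Real.Gamma (α k)) *
    ∏ k, simplexCoord K x k ^ (α k - 1)

open scoped ENNReal

/-- The function `t ↦ t ^ (a - 1)` on the positive half-line, extended by zero. -/
noncomputable def posPow (a t : ℝ) : ℝ≥0∞ :=
  (Set.Ioi (0 : ℝ)).indicator (fun u => ENNReal.ofReal (u ^ (a - 1))) t

@[fun_prop]
theorem measurable_posPow (a : ℝ) : Measurable (posPow a) :=
  Measurable.indicator (by fun_prop) measurableSet_Ioi

theorem posPow_of_pos {a t : ℝ} (ht : 0 < t) : posPow a t = ENNReal.ofReal (t ^ (a - 1)) :=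
  Set.indicator_of_mem (Set.mem_Ioi.2 ht) _

theorem posPow_of_nonpos {a t : ℝ} (ht : t ≤ 0) : posPow a t = 0 :=
  Set.indicator_of_notMem (by simpa using ht) _

theorem posPow_mul {a c : ℝ} (hc : 0 < c) (t : ℝ) :
    posPow a (c * t) = ENNReal.ofReal (c ^ (a - 1)) * posPow a t := by
  rcases lt_or_ge 0 t with ht | ht
  · rw [posPow_of_pos ht, posPow_of_pos (mul_pos hc ht), Real.mul_rpow hc.le ht.le,
      ENNReal.ofReal_mul (by positivity)]
  · rw [posPow_of_nonpos ht, posPow_of_nonpos (mul_nonpos_of_nonneg_of_nonpos hc.le ht), mul_zero]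

theorem lintegral_posPow_mul_exp_neg {a : ℝ} (ha : 0 < a) :
    ∫⁻ t, posPow a t * ENNReal.ofReal (Real.exp (-t)) = ENNReal.ofReal (Real.Gamma a) := by
  rw [Real.Gamma_eq_integral ha,
    ofReal_integral_eq_lintegral_ofReal (Real.GammaIntegral_convergent ha)
      ((ae_restrict_iff' measurableSet_Ioi).2 (.of_forall fun t ht => by
        have : (0 : ℝ) < t := ht
        dsimp; positivity)),
    ← lintegral_indicator measurableSet_Ioi]
  congr 1 with t
  by_cases ht : 0 < t
  · rw [posPow_of_pos ht, Set.indicator_of_mem (Set.mem_Ioi.2 ht), ENNReal.ofReal_mul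
      (by positivity), mul_comm]
  · rw [posPow_of_nonpos (not_lt.1 ht), Set.indicator_of_notMem (by simpa using ht), zero_mul]

theorem lintegral_prod_apply_eq_prod {n : ℕ} (f : Fin n → ℝ → ℝ≥0∞)
    (hf : ∀ i, Measurable (f i)) :
    ∫⁻ x : Fin n → ℝ, ∏ i, f i (x i) = ∏ i, ∫⁻ t, f i t := by
  induction n with
  | zero => simp [volume_pi]
  | succ n ih =>
    have hmp := (volume_preserving_piFinSuccAbove (fun _ : Fin (n + 1) => ℝ) 0).symm
    rw [← hmp.lintegral_comp_emb (MeasurableEquiv.measurableEmbedding _)]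
    simp only [MeasurableEquiv.piFinSuccAbove_symm_apply, Fin.insertNthEquiv, Equiv.coe_fn_mk,
      Fin.prod_univ_succ, Fin.insertNth_zero, Fin.cons_zero, Fin.cons_succ]
    rw [Measure.volume_eq_prod, ← ih _ fun i => hf i.succ]
    exact lintegral_prod_mul (μ := volume) (ν := volume) (f := f 0)
      (g := fun y : Fin n → ℝ => ∏ i, f i.succ (y i)) (hf 0).aemeasurable
      (Finset.measurable_prod _ fun i _ =>
        (hf i.succ).comp (measurable_pi_apply i)).aemeasurable

theorem lintegral_comp_smul_pi {n : ℕ} {c : ℝ} (hc : 0 < c) (f : (Fin n → ℝ) → ℝ≥0∞) :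
    ∫⁻ y, f y = ENNReal.ofReal (c ^ n) * ∫⁻ y, f (c • y) := by
  have key : ∫⁻ y, f (c • y) = ∫⁻ y, f y ∂(Measure.map (c • ·) volume) :=
    (lintegral_map_equiv f (MeasurableEquiv.smul₀ c hc.ne')).symm
  rw [key, Measure.map_addHaar_smul _ hc.ne', lintegral_smul_measure, smul_eq_mul, ← mul_assoc,
    ← ENNReal.ofReal_mul (by positivity), Module.finrank_fin_fun, abs_of_pos (by positivity),
    mul_inv_cancel₀ (by positivity), ENNReal.ofReal_one, one_mul]

/-- The unnormalized Dirichlet density on the simplex of total mass `s`, extended by zero. -/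
noncomputable def dirichletKernel {n : ℕ} (α : Fin (n + 1) → ℝ) (y : Fin n → ℝ) (s : ℝ) : ℝ≥0∞ :=
  (∏ i : Fin n, posPow (α i.castSucc) (y i)) * posPow (α (Fin.last n)) (s - ∑ i, y i)

theorem measurable_dirichletKernel {n : ℕ} (α : Fin (n + 1) → ℝ) :
    Measurable (Function.uncurry (dirichletKernel α)) := by
  unfold dirichletKernel Function.uncurry
  fun_prop

theorem measurable_dirichletKernel_left {n : ℕ} (α : Fin (n + 1) → ℝ) (s : ℝ) :
    Measurable fun y => dirichletKernel α y s :=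
  (measurable_dirichletKernel α).comp (measurable_id.prodMk measurable_const)

theorem dirichletKernel_of_nonpos {n : ℕ} (α : Fin (n + 1) → ℝ) (y : Fin n → ℝ) {s : ℝ}
    (hs : s ≤ 0) : dirichletKernel α y s = 0 := by
  unfold dirichletKernel
  by_cases hy : ∀ i, 0 < y i
  · rw [posPow_of_nonpos (a := α (Fin.last n)), mul_zero]
    linarith [Finset.sum_nonneg fun i (_ : i ∈ Finset.univ) => (hy i).le]
  · push Not at hy
    obtain ⟨i, hi⟩ := hy
    rw [Finset.prod_eq_zero (Finset.mem_univ i) (posPow_of_nonpos hi), zero_mul]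

theorem dirichletKernel_smul {n : ℕ} (α : Fin (n + 1) → ℝ) (y : Fin n → ℝ) {c : ℝ} (hc : 0 < c) :
    dirichletKernel α (c • y) c =
      ENNReal.ofReal (c ^ (∑ k, (α k - 1))) * dirichletKernel α y 1 := by
  have h : c - ∑ i, c * y i = c * (1 - ∑ i, y i) := by rw [← Finset.mul_sum]; ring
  simp only [dirichletKernel, Pi.smul_apply, smul_eq_mul, h, posPow_mul hc,
    Finset.prod_mul_distrib]
  rw [Real.rpow_sum_of_pos hc, Fin.prod_univ_castSucc, ENNReal.ofReal_mul
    (Finset.prod_nonneg fun i _ => by positivity), ENNReal.ofReal_prod_of_nonneg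
    fun i _ => by positivity]
  ring

theorem lintegral_dirichletKernel_scale {n : ℕ} (α : Fin (n + 1) → ℝ) (s : ℝ) :
    ∫⁻ y, dirichletKernel α y s =
      posPow (∑ k, α k) s * ∫⁻ y, dirichletKernel α y 1 := by
  rcases lt_or_ge 0 s with hs | hs
  · rw [lintegral_comp_smul_pi hs]
    simp only [dirichletKernel_smul α _ hs]
    rw [lintegral_const_mul _ (measurable_dirichletKernel_left α 1), ← mul_assoc,
      ← ENNReal.ofReal_mul (by positivity),
      posPow_of_pos hs, ← Real.rpow_natCast, ← Real.rpow_add hs]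
    congr 3
    simp
    ring
  · simp [posPow_of_nonpos hs, dirichletKernel_of_nonpos α _ hs]

theorem lintegral_dirichletKernel_mul_Gamma {n : ℕ} (α : Fin (n + 1) → ℝ) (hα : ∀ k, 0 < α k) :
    ENNReal.ofReal (Real.Gamma (∑ k, α k)) * ∫⁻ y, dirichletKernel α y 1 =
      ENNReal.ofReal (∏ k, Real.Gamma (α k)) := by
  have hm := measurable_dirichletKernel α
  have hα₀ : 0 < ∑ k, α k := Finset.sum_pos (fun k _ => hα k) Finset.univ_nonempty
  have inner (y : Fin n → ℝ) :
      ∫⁻ s, dirichletKernel α y s * ENNReal.ofReal (Real.exp (-s)) =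
        (∏ i : Fin n, posPow (α i.castSucc) (y i) * ENNReal.ofReal (Real.exp (-(y i)))) *
          ENNReal.ofReal (Real.Gamma (α (Fin.last n))) := by
    rw [← lintegral_posPow_mul_exp_neg (hα _), ← lintegral_const_mul _ (by fun_prop),
      ← lintegral_add_right_eq_self _ (∑ i, y i)]
    congr 1 with r
    rw [Finset.prod_mul_distrib, ← ENNReal.ofReal_prod_of_nonneg fun i _ => by positivity,
      ← Real.exp_sum, Finset.sum_neg_distrib, neg_add_rev, Real.exp_add,
      ENNReal.ofReal_mul (by positivity), dirichletKernel, add_sub_cancel_right]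
    ring
  calc
    _ = ∫⁻ s, posPow (∑ k, α k) s * ENNReal.ofReal (Real.exp (-s)) *
          ∫⁻ y, dirichletKernel α y 1 := by
      rw [lintegral_mul_const _ (by fun_prop), lintegral_posPow_mul_exp_neg hα₀]
    _ = ∫⁻ s, ∫⁻ y, dirichletKernel α y s * ENNReal.ofReal (Real.exp (-s)) := by
      congr 1 with s
      rw [lintegral_mul_const _ (measurable_dirichletKernel_left α s),
        lintegral_dirichletKernel_scale α s]
      ring
    _ = ∫⁻ y, ∫⁻ s, dirichletKernel α y s * ENNReal.ofReal (Real.exp (-s)) := by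
      refine lintegral_lintegral_swap (Measurable.aemeasurable ?_)
      exact (hm.comp measurable_swap).mul (by fun_prop)
    _ = _ := by
      simp only [inner]
      rw [lintegral_mul_const _ (by fun_prop), lintegral_prod_apply_eq_prod
        (fun (i : Fin n) t => posPow (α i.castSucc) t * ENNReal.ofReal (Real.exp (-t)))
        (fun i => by fun_prop)]
      simp only [lintegral_posPow_mul_exp_neg (hα _)]
      rw [← ENNReal.ofReal_prod_of_nonneg fun i _ => (Real.Gamma_pos_of_pos (hα _)).le,
        ← ENNReal.ofReal_mul (Finset.prod_nonneg fun i _ => (Real.Gamma_pos_of_pos (hα _)).le),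
        Fin.prod_univ_castSucc]

theorem simplexCoord_castSucc {n : ℕ} (x : Fin n → ℝ) (i : Fin n) :
    simplexCoord (n + 1) x i.castSucc = x i := by
  simp [simplexCoord]

theorem simplexCoord_last {n : ℕ} (x : Fin n → ℝ) :
    simplexCoord (n + 1) x (Fin.last n) = 1 - ∑ i, x i := by
  simp [simplexCoord]

@[fun_prop]
theorem measurable_simplexCoord (K : ℕ) (k : Fin K) :
    Measurable fun x => simplexCoord K x k := by
  unfold simplexCoord
  split_ifs <;> fun_prop

theorem mem_simplexT_iff {n : ℕ} {x : Fin n → ℝ} :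
    x ∈ simplexT (n + 1) ↔ ∀ k, 0 < simplexCoord (n + 1) x k := by
  rw [Fin.forall_fin_succ']
  simp only [simplexCoord_castSucc, simplexCoord_last, sub_pos]
  rfl

theorem measurableSet_simplexT (n : ℕ) : MeasurableSet (simplexT (n + 1)) := by
  have : simplexT (n + 1) = ⋂ k, {x | 0 < simplexCoord (n + 1) x k} := by
    ext x; simpa using mem_simplexT_iff
  rw [this]
  exact .iInter fun k => measurableSet_lt measurable_const (measurable_simplexCoord _ k)

theorem dirichletKernel_one_eq_indicator {n : ℕ} (α : Fin (n + 1) → ℝ) (x : Fin n → ℝ) :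
    dirichletKernel α x 1 = (simplexT (n + 1)).indicator
      (fun x => ENNReal.ofReal (∏ k, simplexCoord (n + 1) x k ^ (α k - 1))) x := by
  have h : dirichletKernel α x 1 = ∏ k, posPow (α k) (simplexCoord (n + 1) x k) := by
    rw [Fin.prod_univ_castSucc, simplexCoord_last]
    simp only [simplexCoord_castSucc, dirichletKernel]
  rw [h]
  by_cases hx : x ∈ simplexT (n + 1)
  · have hx' := mem_simplexT_iff.1 hx
    rw [Set.indicator_of_mem hx, ENNReal.ofReal_prod_of_nonneg
      fun k _ => Real.rpow_nonneg (hx' k).le _]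
    exact Finset.prod_congr rfl fun k _ => posPow_of_pos (hx' k)
  · rw [Set.indicator_of_notMem hx]
    rw [mem_simplexT_iff] at hx
    push Not at hx
    obtain ⟨k, hk⟩ := hx
    exact Finset.prod_eq_zero (Finset.mem_univ k) (posPow_of_nonpos hk)

theorem prod_simplexCoord_rpow_pos {n : ℕ} (β : Fin (n + 1) → ℝ) {x : Fin n → ℝ}
    (hx : x ∈ simplexT (n + 1)) : 0 < ∏ k, simplexCoord (n + 1) x k ^ β k :=
  Finset.prod_pos fun k _ => Real.rpow_pos_of_pos (mem_simplexT_iff.1 hx k) _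

theorem setLIntegral_prod_simplexCoord_rpow {n : ℕ} (α : Fin (n + 1) → ℝ) (hα : ∀ k, 0 < α k) :
    ∫⁻ x in simplexT (n + 1), ENNReal.ofReal (∏ k, simplexCoord (n + 1) x k ^ (α k - 1)) =
      ENNReal.ofReal ((∏ k, Real.Gamma (α k)) / Real.Gamma (∑ k, α k)) := by
  have hΓ : 0 < Real.Gamma (∑ k, α k) :=
    Real.Gamma_pos_of_pos (Finset.sum_pos (fun k _ => hα k) Finset.univ_nonempty)
  have h := lintegral_dirichletKernel_mul_Gamma α hα
  simp only [dirichletKernel_one_eq_indicator] at h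
  rw [ENNReal.ofReal_div_of_pos hΓ, ENNReal.eq_div_iff (by simpa using hΓ) ENNReal.ofReal_ne_top,
    ← h]
  congr 1
  exact (lintegral_indicator (measurableSet_simplexT n) _).symm

theorem ae_prod_simplexCoord_rpow_nonneg {n : ℕ} (β : Fin (n + 1) → ℝ) :
    0 ≤ᵐ[volume.restrict (simplexT (n + 1))]
      fun x => ∏ k, simplexCoord (n + 1) x k ^ β k :=
  (ae_restrict_iff' (measurableSet_simplexT n)).2
    (.of_forall fun _ hx => (prod_simplexCoord_rpow_pos β hx).le)

theorem integrableOn_prod_simplexCoord_rpow {n : ℕ} (α : Fin (n + 1) → ℝ) (hα : ∀ k, 0 < α k) :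
    IntegrableOn (fun x => ∏ k, simplexCoord (n + 1) x k ^ (α k - 1)) (simplexT (n + 1)) := by
  refine ⟨Measurable.aestronglyMeasurable (by fun_prop), ?_⟩
  rw [hasFiniteIntegral_iff_ofReal (ae_prod_simplexCoord_rpow_nonneg _),
    setLIntegral_prod_simplexCoord_rpow α hα]
  exact ENNReal.ofReal_lt_top

/-- The **Dirichlet integral**. -/
theorem integral_prod_simplexCoord_rpow {n : ℕ} (α : Fin (n + 1) → ℝ) (hα : ∀ k, 0 < α k) :
    ∫ x in simplexT (n + 1), ∏ k, simplexCoord (n + 1) x k ^ (α k - 1) =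
      (∏ k, Real.Gamma (α k)) / Real.Gamma (∑ k, α k) := by
  rw [integral_eq_lintegral_of_nonneg_ae (ae_prod_simplexCoord_rpow_nonneg _)
    (Measurable.aestronglyMeasurable (by fun_prop)), setLIntegral_prod_simplexCoord_rpow α hα,
    ENNReal.toReal_ofReal]
  exact div_nonneg (Finset.prod_nonneg fun k _ => (Real.Gamma_pos_of_pos (hα k)).le)
    (Real.Gamma_pos_of_pos (Finset.sum_pos (fun k _ => hα k) Finset.univ_nonempty)).le

theorem exp_mul_log_prod_simplexCoord_rpow {n : ℕ} (β : Fin (n + 1) → ℝ) (t : ℝ) {x : Fin n → ℝ}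
    (hx : x ∈ simplexT (n + 1)) :
    Real.exp (t * Real.log (∏ k, simplexCoord (n + 1) x k ^ β k)) =
      ∏ k, simplexCoord (n + 1) x k ^ (1 + t * β k - 1) := by
  have hx' := mem_simplexT_iff.1 hx
  rw [mul_comm, ← Real.rpow_def_of_pos (prod_simplexCoord_rpow_pos β hx),
    ← Real.finsetProd_rpow _ _ fun k _ => Real.rpow_nonneg (hx' k).le _]
  refine Finset.prod_congr rfl fun k _ => ?_
  rw [← Real.rpow_mul (hx' k).le]
  ring_nf

theorem hasDerivAt_log_Gamma {s : ℝ} (hs : 0 < s) :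
    HasDerivAt (fun s => Real.log (Real.Gamma s))
      (deriv (fun s => Real.log (Real.Gamma s)) s) s :=
  ((Real.differentiableAt_Gamma fun m =>
    by have : (0 : ℝ) ≤ m := m.cast_nonneg
       linarith).log (Real.Gamma_pos_of_pos hs).ne').hasDerivAt

theorem hasDerivAt_prod_Gamma_div {ι : Type*} [Fintype ι] [Nonempty ι] (α β : ι → ℝ) (t : ℝ)
    (h : ∀ k, 0 < α k + t * β k) :
    HasDerivAt (fun t => (∏ k, Real.Gamma (α k + t * β k)) / Real.Gamma (∑ k, (α k + t * β k)))
      ((∏ k, Real.Gamma (α k + t * β k)) / Real.Gamma (∑ k, (α k + t * β k)) *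
        ∑ k, β k * (deriv (fun s => Real.log (Real.Gamma s)) (α k + t * β k) -
          deriv (fun s => Real.log (Real.Gamma s)) (∑ m, (α m + t * β m)))) t := by
  have hk (k : ι) : HasDerivAt (fun t => α k + t * β k) (β k) t := by
    simpa using ((hasDerivAt_id t).mul_const (β k)).const_add (α k)
  have hsum : HasDerivAt (fun t => ∑ k, (α k + t * β k)) (∑ k, β k) t :=
    HasDerivAt.fun_sum fun k _ => hk k
  have hpos : 0 < ∑ k, (α k + t * β k) := Finset.sum_pos (fun k _ => h k) Finset.univ_nonempty
  have hlog : HasDerivAt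
      (fun t => ∑ k, Real.log (Real.Gamma (α k + t * β k)) -
        Real.log (Real.Gamma (∑ k, (α k + t * β k))))
      (∑ k, β k * (deriv (fun s => Real.log (Real.Gamma s)) (α k + t * β k) -
          deriv (fun s => Real.log (Real.Gamma s)) (∑ m, (α m + t * β m)))) t := by
    have h1 := (HasDerivAt.fun_sum fun k (_ : k ∈ Finset.univ) =>
      (hasDerivAt_log_Gamma (h k)).comp t (hk k)).sub ((hasDerivAt_log_Gamma hpos).comp t hsum)
    convert! h1 using 1
    simp only [mul_sub, Finset.sum_sub_distrib, ← Finset.sum_mul, mul_comm]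
  have hexp (u : ℝ) (hu : ∀ k, 0 < α k + u * β k) :
      Real.exp (∑ k, Real.log (Real.Gamma (α k + u * β k)) -
        Real.log (Real.Gamma (∑ k, (α k + u * β k)))) =
      (∏ k, Real.Gamma (α k + u * β k)) / Real.Gamma (∑ k, (α k + u * β k)) := by
    rw [Real.exp_sub, Real.exp_sum, Real.exp_log (Real.Gamma_pos_of_pos
      (Finset.sum_pos (fun k _ => hu k) Finset.univ_nonempty))]
    simp only [fun k => Real.exp_log (Real.Gamma_pos_of_pos (hu k))]
  have hev : ∀ᶠ u in nhds t, ∀ k, 0 < α k + u * β k :=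
    Filter.eventually_all.2 fun k => (hk k).continuousAt.eventually_const_lt (h k)
  rw [← hexp t h]
  exact hlog.exp.congr_of_eventuallyEq (hev.mono fun u hu => (hexp u hu).symm)


theorem integral_mul_log_prod_simplexCoord_rpow {n : ℕ} (α : Fin (n + 1) → ℝ)
    (hα : ∀ k, 0 < α k) :
    IntegrableOn (fun x => (∏ k, simplexCoord (n + 1) x k ^ (α k - 1)) *
      Real.log (∏ k, simplexCoord (n + 1) x k ^ (α k - 1))) (simplexT (n + 1)) ∧
    ∫ x in simplexT (n + 1), (∏ k, simplexCoord (n + 1) x k ^ (α k - 1)) *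
      Real.log (∏ k, simplexCoord (n + 1) x k ^ (α k - 1)) =
      (∏ k, Real.Gamma (α k)) / Real.Gamma (∑ k, α k) *
        ∑ k, (α k - 1) * (deriv (fun s => Real.log (Real.Gamma s)) (α k) -
          deriv (fun s => Real.log (Real.Gamma s)) (∑ m, α m)) := by
  set X : (Fin n → ℝ) → ℝ := fun x => Real.log (∏ k, simplexCoord (n + 1) x k ^ (α k - 1))
  set μ : Measure (Fin n → ℝ) := volume.restrict (simplexT (n + 1))
  have hone (k : Fin (n + 1)) : 1 + 1 * (α k - 1) = α k := by ring
  have hpos : ∀ᶠ t in nhds (1 : ℝ), ∀ k, 0 < 1 + t * (α k - 1) :=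
    Filter.eventually_all.2 fun k =>
      (show ContinuousAt (fun t : ℝ => 1 + t * (α k - 1)) 1 by fun_prop).eventually_const_lt
        (by simpa using hα k)
  have hmem : 1 ∈ interior (ProbabilityTheory.integrableExpSet X μ) :=
    mem_interior_iff_mem_nhds.2 <| hpos.mono fun t ht =>
      (integrableOn_prod_simplexCoord_rpow _ ht).congr_fun
        (fun x hx => (exp_mul_log_prod_simplexCoord_rpow _ t hx).symm) (measurableSet_simplexT n)
  have hmgf : ProbabilityTheory.mgf X μ =ᶠ[nhds 1] fun t =>
      (∏ k, Real.Gamma (1 + t * (α k - 1))) / Real.Gamma (∑ k, (1 + t * (α k - 1))) :=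
    hpos.mono fun t ht => (setIntegral_congr_fun (measurableSet_simplexT n)
      fun x hx => exp_mul_log_prod_simplexCoord_rpow _ t hx).trans
        (integral_prod_simplexCoord_rpow _ ht)
  have hcongr : Set.EqOn (fun x => X x * Real.exp (1 * X x))
      (fun x => (∏ k, simplexCoord (n + 1) x k ^ (α k - 1)) * X x) (simplexT (n + 1)) := by
    intro x hx
    simp only [X, one_mul, Real.exp_log (prod_simplexCoord_rpow_pos _ hx), mul_comm]
  constructor
  · have := ProbabilityTheory.integrable_pow_mul_exp_of_mem_interior_integrableExpSet hmem 1
    simp only [pow_one] at this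
    exact IntegrableOn.congr_fun this hcongr (measurableSet_simplexT n)
  · have hd := (ProbabilityTheory.hasDerivAt_mgf hmem).unique
      ((hasDerivAt_prod_Gamma_div (fun _ => 1) (fun k => α k - 1) 1
        (fun k => by rw [hone]; exact hα k)).congr_of_eventuallyEq hmgf)
    simp only [hone] at hd
    rw [← hd]
    exact (setIntegral_congr_fun (measurableSet_simplexT n) hcongr).symm

/-- Equation (5): the uniform Dirichlet `Dir(1,…,1)` has constant density `Γ(K)`
on the simplex, and the KL divergence from `Dir(α)` to `Dir(1,…,1)` equals
`log (Γ(α₀) / (Γ(K) ∏ₖ Γ(αₖ))) + ∑ₖ (αₖ - 1)(ψ(αₖ) - ψ(α₀))`,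
where `ψ` is the digamma function. -/
theorem dirichlet_kl_to_uniform (K : ℕ) (hK : 2 ≤ K)
    (α : Fin K → ℝ) (hα : ∀ k, 0 < α k)
    (ψ : ℝ → ℝ) (hψ : ψ = deriv (fun s => Real.log (Real.Gamma s))) :
    (∀ x ∈ simplexT K, dirDensity K (fun _ => 1) x = Real.Gamma K) ∧
    (∫ x in simplexT K,
        dirDensity K α x * Real.log (dirDensity K α x / Real.Gamma K) =
      Real.log (Real.Gamma (∑ m, α m) /
          (Real.Gamma K * ∏ k, Real.Gamma (α k))) +
        ∑ k, (α k - 1) * (ψ (α k) - ψ (∑ m, α m))) := by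
  subst hψ
  obtain ⟨n, rfl⟩ : ∃ n, K = n + 1 := ⟨K - 1, by lia⟩
  have hpos {s : ℝ} (hs : 0 < s) : 0 < Real.Gamma s := Real.Gamma_pos_of_pos hs
  have hα₀ : 0 < Real.Gamma (∑ k, α k) :=
    hpos (Finset.sum_pos (fun k _ => hα k) Finset.univ_nonempty)
  have hprod : 0 < ∏ k, Real.Gamma (α k) := Finset.prod_pos fun k _ => hpos (hα k)
  have hK' : 0 < Real.Gamma ((n + 1 : ℕ) : ℝ) := hpos (by positivity)
  refine ⟨fun x _ => by simp [dirDensity], ?_⟩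
  have hB : Real.Gamma (∑ k, α k) / (∏ k, Real.Gamma (α k)) *
      ((∏ k, Real.Gamma (α k)) / Real.Gamma (∑ k, α k)) = 1 := by field_simp
  set C := Real.Gamma (∑ k, α k) / ∏ k, Real.Gamma (α k) with hC
  have hCpos : 0 < C := div_pos hα₀ hprod
  set F : (Fin n → ℝ) → ℝ := fun x => ∏ k, simplexCoord (n + 1) x k ^ (α k - 1)
  obtain ⟨hint, hval⟩ := integral_mul_log_prod_simplexCoord_rpow α hα
  calc
    _ = ∫ x in simplexT (n + 1), (C * Real.log (C / Real.Gamma (n + 1 : ℕ)) * F x +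
          C * (F x * Real.log (F x))) := by
      refine setIntegral_congr_fun (measurableSet_simplexT n) fun x hx => ?_
      have hFx : 0 < F x := prod_simplexCoord_rpow_pos _ hx
      have hd : dirDensity (n + 1) α x = C * F x := rfl
      simp only [hd]
      rw [mul_div_right_comm, Real.log_mul (div_pos hCpos hK').ne' hFx.ne']
      ring
    _ = _ := by
      rw [integral_add ((integrableOn_prod_simplexCoord_rpow α hα).const_mul _)
        (hint.const_mul _), integral_const_mul, integral_const_mul, hval,
        integral_prod_simplexCoord_rpow α hα, ← mul_assoc, hB, one_mul, mul_right_comm, hB,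
        one_mul, hC, div_div, mul_comm (∏ k, Real.Gamma (α k))]
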